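/- arXiv:1708.03054 — 2 statements merged into one kernel-verified Lean document; each statement's English description precedes it below -/
import Mathlib

section
/- (No large Voronoi cells, Lemma 4.3.) There exists a constant c > 0 such that for every n ≥ 1, P_{n,1/2}[E_n] ≤ exp(−c·n^{1/3}), where E_n is the event that some Voronoi cell of η has radius larger than n^{−1/3}, i.e., that there exist (x,u) ∈ η and y ∈ V(x) with dist(x,y) > n^{−1/3}. -/
open MeasureTheory ProbabilityTheory Set Filter
open scoped ENNReal

noncomputable section

abbrev Plane : Type := EuclideanSpace ℝ (Fin 2)
abbrev Pt : Type := Plane × Bool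
abbrev Config : Type := Set Pt

/-- The unit square `S = [0,1]²`. -/
def Sq : Set Plane := {x | x 0 ∈ Icc (0:ℝ) 1 ∧ x 1 ∈ Icc (0:ℝ) 1}

/-- The law of the mark of a point: `1` (blue) with probability `p`, `0` (red) otherwise. -/
def markLaw (p : ℝ) : Measure Bool :=
  p.toNNReal • Measure.dirac true + (1 - p).toNNReal • Measure.dirac false

/-- The law of a single point of the process: uniform location in `S`, independent mark. -/
def ptLaw (p : ℝ) : Measure Pt := (volume.restrict Sq).prod (markLaw p)

/-- Poisson probability mass function with parameter `r`. -/
def pois (r : ℝ) (N : ℕ) : ℝ := Real.exp (-r) * r ^ N / N.factorial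

/-- The configuration determined by a finite list of marked points. -/
def cfgOf {N : ℕ} (x : Fin N → Pt) : Config := Set.range x

/-- Expectation of `g` under the Poisson Voronoi law `P_{n,p}`. -/
def PE (n p : ℝ) (g : Config → ℝ) : ℝ :=
  ∑' N : ℕ, pois n N * ∫ x : Fin N → Pt, g (cfgOf x) ∂(Measure.pi fun _ => ptLaw p)

/-- `y ∈ S` is blue if it belongs to the Voronoi cell of a blue point of `η`. -/
def isBlue (η : Config) (y : Plane) : Prop :=
  ∃ q ∈ η, q.2 = true ∧ ∀ r ∈ η, dist y q.1 ≤ dist y r.1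

/-- The rectangle `[a,b] × [c,d]`. -/
def rect (a b c d : ℝ) : Set Plane := {x | x 0 ∈ Icc a b ∧ x 1 ∈ Icc c d}

/-- The horizontal blue crossing event `H_R` for `R = [a,b] × [c,d]`. -/
def Crossing (a b c d : ℝ) (η : Config) : Prop :=
  ∃ K : Set Plane, K ⊆ {y | y ∈ rect a b c d ∧ isBlue η y} ∧ IsConnected K ∧
    (∃ y ∈ K, y 0 = a) ∧ (∃ y ∈ K, y 0 = b)

open Classical in
/-- The indicator `f_R` of the crossing event. -/
def fR (a b c d : ℝ) (η : Config) : ℝ := if Crossing a b c d η then 1 else 0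

/-- Uniform measure on `[0,1]`. -/
def unif01 : Measure ℝ := volume.restrict (Icc (0:ℝ) 1)

/-- Joint expectation of `g (η, η(ε))` where `η ~ P_{n,p}` and `η(ε)` is the `ε`-perturbation
of `η`: each point of `η` is deleted independently with probability `ε` and an independent
process of law `P_{εn,p}` is added. -/
def PE2pert (n p ε : ℝ) (g : Config → Config → ℝ) : ℝ :=
  ∑' N : ℕ, ∑' M : ℕ, pois n N * pois (ε * n) M *
    ∫ x : Fin N → Pt, ∫ y : Fin M → Pt, ∫ u : Fin N → ℝ,
      g (cfgOf x) ({q | ∃ i, x i = q ∧ ε ≤ u i} ∪ cfgOf y)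
      ∂(Measure.pi fun _ => unif01) ∂(Measure.pi fun _ => ptLaw p)
      ∂(Measure.pi fun _ => ptLaw p)

/-- The event that some Voronoi cell of `η` has radius larger than `n^{-1/3}`: there are a
point `q ∈ η` and a point `y` of its Voronoi cell with `dist (q.1) y > n^{-1/3}`. -/
def bigCell (n : ℝ) (η : Config) : Prop :=
  ∃ q ∈ η, ∃ y ∈ Sq, (∀ r ∈ η, dist y q.1 ≤ dist y r.1) ∧ n ^ (-(1:ℝ)/3) < dist q.1 y

/-- The closed cell with index `(i, j)` of the subdivision of the unit square into `k × k` squares. -/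
def gridCell (k : ℕ) (s : Fin k × Fin k) : Set Plane :=
  rect (s.1 / k) ((s.1 + 1) / k) (s.2 / k) ((s.2 + 1) / k)

lemma rect_eq_preimage (a b c d : ℝ) :
    rect a b c d = (MeasurableEquiv.toLp 2 (Fin 2 → ℝ)).symm ⁻¹' Icc ![a, c] ![b, d] := by
  ext x
  simp only [rect, Set.mem_ofPred_eq, Set.mem_preimage, Set.mem_Icc, Pi.le_def, Fin.forall_fin_two,
    MeasurableEquiv.coe_toLp_symm, Matrix.cons_val_zero, Matrix.cons_val_one]
  tauto

lemma measurableSet_rect (a b c d : ℝ) : MeasurableSet (rect a b c d) := by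
  rw [rect_eq_preimage]
  exact (MeasurableEquiv.measurable _) measurableSet_Icc

lemma volume_rect (a b c d : ℝ) :
    volume (rect a b c d) = ENNReal.ofReal (b - a) * ENNReal.ofReal (d - c) := by
  rw [rect_eq_preimage, (EuclideanSpace.volume_preserving_symm_measurableEquiv_toLp
    (Fin 2)).measure_preimage measurableSet_Icc.nullMeasurableSet, Real.volume_Icc_pi]
  simp [Fin.prod_univ_two]

lemma sq_eq_rect : Sq = rect 0 1 0 1 := rfl

instance isProbabilityMeasure_markLaw : IsProbabilityMeasure (markLaw (1 / 2)) := by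
  constructor
  have h : (2⁻¹ : ℝ).toNNReal = (2⁻¹ : NNReal) := by
    rw [Real.toNNReal_inv]; simp
  have h' : (1 - 2⁻¹ : ℝ) = 2⁻¹ := by norm_num
  simp only [markLaw, one_div, h', h, Measure.coe_add, Pi.add_apply, Measure.smul_apply,
    measure_univ, ENNReal.smul_def, smul_eq_mul, mul_one]
  rw [ENNReal.coe_inv two_ne_zero]
  exact ENNReal.inv_two_add_inv_two

instance isProbabilityMeasure_volume_restrict_sq :
    IsProbabilityMeasure (volume.restrict Sq) := by
  constructor
  simp [sq_eq_rect, volume_rect]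

instance isProbabilityMeasure_ptLaw : IsProbabilityMeasure (ptLaw (1 / 2)) := by
  unfold ptLaw; infer_instance

lemma gridCell_subset_sq {k : ℕ} (s : Fin k × Fin k) : gridCell k s ⊆ Sq := by
  have hk : (0 : ℝ) < k := by exact_mod_cast s.1.pos
  have h (i : Fin k) : (0 : ℝ) ≤ i / k ∧ ((i : ℝ) + 1) / k ≤ 1 := by
    refine ⟨by positivity, ?_⟩
    rw [div_le_one hk]
    exact_mod_cast i.isLt
  rintro y ⟨hy₀, hy₁⟩
  exact ⟨⟨(h s.1).1.trans hy₀.1, hy₀.2.trans (h s.1).2⟩,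
    ⟨(h s.2).1.trans hy₁.1, hy₁.2.trans (h s.2).2⟩⟩

lemma ptLaw_real_compl_gridCell {k : ℕ} (s : Fin k × Fin k) :
    (ptLaw (1 / 2)).real (Prod.fst ⁻¹' (gridCell k s)ᶜ) = 1 - 1 / (k : ℝ) ^ 2 := by
  have hm : MeasurableSet (gridCell k s) := measurableSet_rect ..
  rw [preimage_compl, probReal_compl_eq_one_sub (measurable_fst hm)]
  congr 1
  have hprod : (Prod.fst ⁻¹' gridCell k s : Set Pt) = gridCell k s ×ˢ univ := by
    ext; simp
  rw [hprod, ptLaw, measureReal_prod_prod, probReal_univ, mul_one, measureReal_def,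
    Measure.restrict_apply hm, inter_eq_left.2 (gridCell_subset_sq s), gridCell, volume_rect]
  have h (i : ℝ) : (i + 1) / k - i / k = 1 / k := by ring
  rw [h, h, ENNReal.toReal_mul, ENNReal.toReal_ofReal (by positivity)]
  ring

lemma exists_fin_div_le {k : ℕ} (hk : 0 < k) {y : ℝ} (hy : y ∈ Icc (0 : ℝ) 1) :
    ∃ i : Fin k, y ∈ Icc ((i : ℝ) / k) (((i : ℝ) + 1) / k) := by
  have hk' : (0 : ℝ) < k := by exact_mod_cast hk
  rcases hy.2.eq_or_lt with rfl | hlt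
  · refine ⟨⟨k - 1, by omega⟩, ?_⟩
    simp only [Nat.cast_sub hk, Nat.cast_one, mem_Icc, div_le_one hk', le_div_iff₀ hk']
    constructor <;> linarith
  · refine ⟨⟨⌊y * k⌋₊, (Nat.floor_lt (by nlinarith [hy.1])).2 (by nlinarith)⟩, ?_⟩
    rw [mem_Icc, div_le_iff₀ hk', le_div_iff₀ hk']
    exact ⟨Nat.floor_le (by nlinarith [hy.1]), (Nat.lt_floor_add_one _).le⟩

lemma exists_mem_gridCell {k : ℕ} (hk : 0 < k) {y : Plane} (hy : y ∈ Sq) :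
    ∃ s, y ∈ gridCell k s := by
  obtain ⟨i, hi⟩ := exists_fin_div_le hk hy.1
  obtain ⟨j, hj⟩ := exists_fin_div_le hk hy.2
  exact ⟨(i, j), hi, hj⟩

lemma dist_lt_of_mem_gridCell {k : ℕ} {s : Fin k × Fin k} {y z : Plane}
    (hy : y ∈ gridCell k s) (hz : z ∈ gridCell k s) : dist y z < 2 / k := by
  have hk : (0 : ℝ) < k := by exact_mod_cast s.1.pos
  have h {i u v : ℝ} (hu : u ∈ Icc (i / k) ((i + 1) / k)) (hv : v ∈ Icc (i / k) ((i + 1) / k)) :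
      (u - v) ^ 2 ≤ (1 / k) ^ 2 := by
    have h1 : (i + 1) / k = i / k + 1 / k := by ring
    rw [h1] at hu hv
    exact sq_le_sq' (by linarith [hu.1, hv.2]) (by linarith [hu.2, hv.1])
  rw [EuclideanSpace.dist_eq, Real.sqrt_lt' (by positivity)]
  simp only [Fin.sum_univ_two, Real.dist_eq, sq_abs]
  have h₀ := h hy.1 hz.1
  have h₁ := h hy.2 hz.2
  have h2 : (2 / k : ℝ) ^ 2 = 4 * (1 / k) ^ 2 := by ring
  have hpos : (0 : ℝ) < (1 / k) ^ 2 := by positivity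
  linarith

/-- A large Voronoi cell forces some cell of a fine enough grid to contain no point. -/
lemma bigCell.exists_gridCell_empty {n : ℝ} {η : Config} (h : bigCell n η) {k : ℕ} (hk : 0 < k)
    (hkn : 2 / k ≤ n ^ (-(1 : ℝ) / 3)) : ∃ s, ∀ r ∈ η, r.1 ∉ gridCell k s := by
  obtain ⟨q, -, y, hy, hmin, hlarge⟩ := h
  obtain ⟨s, hs⟩ := exists_mem_gridCell hk hy
  refine ⟨s, fun r hr hrs => ?_⟩
  have := dist_lt_of_mem_gridCell hs hrs
  have := hmin r hr
  rw [dist_comm] at hlarge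
  linarith

lemma not_bigCell_empty (n : ℝ) : ¬ bigCell n ∅ := by
  rintro ⟨q, hq, -⟩
  exact hq

open Classical in
lemma integral_bigCell_le (n : ℝ) {k : ℕ} (hk : 0 < k) (hkn : 2 / k ≤ n ^ (-(1 : ℝ) / 3))
    (N : ℕ) :
    ∫ x : Fin N → Pt, (if bigCell n (cfgOf x) then (1 : ℝ) else 0)
      ∂(Measure.pi fun _ => ptLaw (1 / 2)) ≤ (k : ℝ) ^ 2 * (1 - 1 / (k : ℝ) ^ 2) ^ N := by
  set μ : Measure (Fin N → Pt) := Measure.pi fun _ => ptLaw (1 / 2)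
  let A (s : Fin k × Fin k) : Set (Fin N → Pt) :=
    univ.pi fun _ => Prod.fst ⁻¹' (gridCell k s)ᶜ
  have hA (s) : MeasurableSet (A s) :=
    MeasurableSet.univ_pi fun _ => measurable_fst (measurableSet_rect ..).compl
  have hint (s) : Integrable ((A s).indicator (1 : (Fin N → Pt) → ℝ)) μ :=
    (integrable_const (1 : ℝ)).indicator (hA s)
  calc _ ≤ ∫ x, ∑ s, (A s).indicator (1 : (Fin N → Pt) → ℝ) x ∂μ := by
        refine integral_mono_of_nonneg (ae_of_all _ fun x => ?_)
          (integrable_finsetSum _ fun s _ => hint s) (ae_of_all _ fun x => ?_)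
        · dsimp only [Pi.zero_apply]
          split_ifs <;> norm_num
        · have hnn (s) : 0 ≤ (A s).indicator (1 : (Fin N → Pt) → ℝ) x :=
            indicator_nonneg (fun _ _ => zero_le_one) x
          dsimp only
          split_ifs with hb
          · obtain ⟨s, hs⟩ := hb.exists_gridCell_empty hk hkn
            have hx : x ∈ A s := fun i _ => hs (x i) (mem_range_self i)
            calc (1 : ℝ) = (A s).indicator (1 : (Fin N → Pt) → ℝ) x := by
                  rw [indicator_of_mem hx, Pi.one_apply]
              _ ≤ _ := Finset.single_le_sum (fun s _ => hnn s) (Finset.mem_univ s)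
          · exact Finset.sum_nonneg fun s _ => hnn s
    _ = ∑ s, μ.real (A s) := by
        rw [integral_finsetSum _ fun s _ => hint s]
        exact Finset.sum_congr rfl fun s _ => integral_indicator_one (hA s)
    _ = (k : ℝ) ^ 2 * (1 - 1 / (k : ℝ) ^ 2) ^ N := by
        have h (s) : μ.real (A s) = (1 - 1 / (k : ℝ) ^ 2) ^ N := by
          rw [measureReal_def, Measure.pi_pi, ENNReal.toReal_prod]
          simp only [← measureReal_def, ptLaw_real_compl_gridCell, Finset.prod_const,
            Finset.card_univ, Fintype.card_fin]
        simp only [h, Finset.sum_const, Finset.card_univ, Fintype.card_prod, Fintype.card_fin,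
          nsmul_eq_mul]
        push_cast
        ring

lemma pois_nonneg {r : ℝ} (hr : 0 ≤ r) (N : ℕ) : 0 ≤ pois r N := by
  unfold pois; positivity

/-- The probability generating function of the Poisson law. -/
lemma hasSum_pois_mul_pow (r q : ℝ) :
    HasSum (fun N => pois r N * q ^ N) (Real.exp (-r * (1 - q))) := by
  have h := (NormedSpace.expSeries_div_hasSum_exp (r * q)).mul_left (Real.exp (-r))
  rw [← Real.exp_eq_exp_ℝ, ← Real.exp_add] at h
  rw [show -r * (1 - q) = -r + r * q by ring]
  have hfun (N : ℕ) : pois r N * q ^ N = Real.exp (-r) * ((r * q) ^ N / N.factorial) := by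
    rw [pois, mul_pow]
    ring
  simpa only [hfun] using h

lemma PE_le_of_hasSum {n p S : ℝ} {g : Config → ℝ} {a : ℕ → ℝ} (hn : 0 ≤ n) (hg : ∀ η, 0 ≤ g η)
    (h : ∀ N, ∫ x : Fin N → Pt, g (cfgOf x) ∂(Measure.pi fun _ => ptLaw p) ≤ a N)
    (hS : HasSum (fun N => pois n N * a N) S) : PE n p g ≤ S := by
  have hle (N : ℕ) := mul_le_mul_of_nonneg_left (h N) (pois_nonneg hn N)
  have hsum := hS.summable.of_nonneg_of_le
    (fun N => mul_nonneg (pois_nonneg hn N) (integral_nonneg fun x => hg _)) hle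
  exact (hsum.tsum_le_tsum hle hS.summable).trans_eq hS.tsum_eq

open Classical in
lemma PE_bigCell_le_grid {n : ℝ} (hn : 0 ≤ n) {k : ℕ} (hk : 0 < k)
    (hkn : 2 / k ≤ n ^ (-(1 : ℝ) / 3)) :
    PE n (1 / 2) (fun η => if bigCell n η then 1 else 0)
      ≤ (k : ℝ) ^ 2 * Real.exp (-n / (k : ℝ) ^ 2) := by
  refine PE_le_of_hasSum hn (fun η => by split_ifs <;> norm_num)
    (integral_bigCell_le n hk hkn) ?_
  have h := (hasSum_pois_mul_pow n (1 - 1 / (k : ℝ) ^ 2)).mul_left ((k : ℝ) ^ 2)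
  rw [show -n * (1 - (1 - 1 / (k : ℝ) ^ 2)) = -n / (k : ℝ) ^ 2 by ring] at h
  simpa only [mul_left_comm] using h

open Classical in
lemma PE_bigCell_le_one_sub_exp_neg {n : ℝ} (hn : 0 ≤ n) :
    PE n (1 / 2) (fun η => if bigCell n η then 1 else 0) ≤ 1 - Real.exp (-n) := by
  refine PE_le_of_hasSum (a := fun N => 1 ^ N - 0 ^ N) hn
    (fun η => by split_ifs <;> norm_num) (fun N => ?_) ?_
  · rcases N.eq_zero_or_pos with rfl | hN
    · have h (x : Fin 0 → Pt) : cfgOf x = ∅ := range_eq_empty x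
      simp [h, not_bigCell_empty]
    · have h : ∫ x : Fin N → Pt, (if bigCell n (cfgOf x) then (1 : ℝ) else 0)
          ∂(Measure.pi fun _ => ptLaw (1 / 2)) ≤
          ∫ _ : Fin N → Pt, (1 : ℝ) ∂(Measure.pi fun _ => ptLaw (1 / 2)) := by
        refine integral_mono_of_nonneg (ae_of_all _ fun x => ?_) (integrable_const _)
          (ae_of_all _ fun x => ?_) <;> dsimp only [Pi.zero_apply] <;> split_ifs <;> norm_num
      rw [integral_const, probReal_univ, one_smul] at h
      simpa [hN.ne'] using h
  · simpa [mul_sub] using (hasSum_pois_mul_pow n 1).sub (hasSum_pois_mul_pow n 0)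

open Classical in
/-- For `t = n ^ (1/3)`, a grid of about `4 t ^ 2` cells gives an exponential bound up to a
polynomial prefactor. -/
lemma PE_bigCell_le_sq_mul_exp {t : ℝ} (ht : 1 ≤ t) :
    PE (t ^ 3) (1 / 2) (fun η => if bigCell (t ^ 3) η then 1 else 0)
      ≤ 9 * t ^ 2 * Real.exp (-t / 9) := by
  have ht0 : 0 < t := by linarith
  have hlow : 2 * t ≤ (⌈2 * t⌉₊ : ℝ) := Nat.le_ceil _
  have hup : (⌈2 * t⌉₊ : ℝ) ≤ 3 * t := by
    linarith [Nat.ceil_lt_add_one (show 0 ≤ 2 * t by linarith)]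
  set k := ⌈2 * t⌉₊
  have hk : (0 : ℝ) < k := by linarith
  have hroot : (t ^ 3) ^ (-(1 : ℝ) / 3) = 1 / t := by
    rw [← Real.rpow_natCast, ← Real.rpow_mul ht0.le, one_div, ← Real.rpow_neg_one]
    norm_num
  have hk2 : (k : ℝ) ^ 2 ≤ 9 * t ^ 2 := by nlinarith
  refine (PE_bigCell_le_grid (by positivity) (by exact_mod_cast hk) ?_).trans ?_
  · rw [hroot, div_le_div_iff₀ hk ht0]
    linarith
  · have hexp : -t ^ 3 / (k : ℝ) ^ 2 ≤ -t / 9 := by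
      rw [div_le_div_iff₀ (by positivity) (by norm_num)]
      nlinarith
    gcongr

lemma exists_forall_sq_mul_exp_le :
    ∃ T : ℝ, 1 ≤ T ∧ ∀ t, T ≤ t → 9 * t ^ 2 * Real.exp (-t / 9) ≤ Real.exp (-t / 18) := by
  have h := (Real.tendsto_pow_mul_exp_neg_atTop_nhds_zero 2).comp
    (tendsto_id.atTop_div_const (show (0 : ℝ) < 18 by norm_num))
  obtain ⟨T, hT⟩ := eventually_atTop.1
    (h.eventually_le_const (show (0 : ℝ) < 1 / 2916 by norm_num))
  refine ⟨max T 1, le_max_right _ _, fun t ht => ?_⟩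
  have hb := hT t ((le_max_left _ _).trans ht)
  simp only [Function.comp_apply, id_eq] at hb
  have hexp : Real.exp (-t / 9) = Real.exp (-(t / 18)) * Real.exp (-t / 18) := by
    rw [← Real.exp_add]
    congr 1
    ring
  rw [hexp]
  calc _ = 2916 * ((t / 18) ^ 2 * Real.exp (-(t / 18))) * Real.exp (-t / 18) := by ring
    _ ≤ 1 * Real.exp (-t / 18) := by gcongr; linarith
    _ = _ := one_mul _

open Classical in
/-- **Lemma 4.3.** There is a constant `c > 0` such that the probability under `P_{n,1/2}` that
some Voronoi cell has radius larger than `n^{-1/3}` is at most `exp (-c n^{1/3})`. -/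
theorem no_large_voronoi_cells :
    ∃ cst : ℝ, 0 < cst ∧ ∀ n : ℝ, 1 ≤ n →
      PE n (1/2) (fun η => if bigCell n η then 1 else 0)
        ≤ Real.exp (-cst * n ^ ((1:ℝ)/3)) := by
  obtain ⟨T, hT1, hT⟩ := exists_forall_sq_mul_exp_le
  have hT0 : 0 < T := by linarith
  refine ⟨min (1 / 18) (Real.exp (-T ^ 3) / T), by positivity, fun n hn => ?_⟩
  obtain ⟨t, ht, rfl⟩ : ∃ t : ℝ, 1 ≤ t ∧ t ^ 3 = n := by
    refine ⟨n ^ ((1 : ℝ) / 3), Real.one_le_rpow hn (by norm_num), ?_⟩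
    rw [← Real.rpow_natCast, ← Real.rpow_mul (by linarith)]
    norm_num
  have hroot : (t ^ 3) ^ ((1 : ℝ) / 3) = t := by
    rw [← Real.rpow_natCast, ← Real.rpow_mul (by linarith)]
    norm_num
  rw [hroot]
  rcases le_total T t with hTt | htT
  · refine ((PE_bigCell_le_sq_mul_exp ht).trans (hT t hTt)).trans (Real.exp_le_exp.2 ?_)
    nlinarith [min_le_left (1 / 18) (Real.exp (-T ^ 3) / T)]
  · refine (PE_bigCell_le_one_sub_exp_neg (by positivity)).trans
      ((Real.one_sub_le_exp_neg _).trans (Real.exp_le_exp.2 ?_))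
    rw [neg_mul, neg_le_neg_iff]
    calc _ ≤ Real.exp (-T ^ 3) / T * T := by
          gcongr
          exact min_le_right _ _
      _ = Real.exp (-T ^ 3) := div_mul_cancel₀ _ hT0.ne'
      _ ≤ Real.exp (-t ^ 3) := by gcongr
end
end

section
/- (Lower bound on the derivative via revealment, Section 2.2.) Let f : {0,1}ⁿ → {0,1} be monotone and let A be a randomized algorithm that determines f. Then for every p ∈ (0,1) with δ_p(A, [n]) > 0, the function q ↦ E_q[f] is differentiable at p and (d/dp) E_p[f] ≥ 4 · Var_p(f) / δ_p(A, [n]), where Var_p(f) = E_p[f²] − (E_p[f])². -/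
open MeasureTheory Set

noncomputable section

/-- A deterministic decision tree on `{0,1}ⁿ`: internal nodes query a coordinate, with subtrees
for the two possible values, and leaves output a bit. -/
inductive DTree (n : ℕ) : Type where
  | leaf : Bool → DTree n
  | node : Fin n → DTree n → DTree n → DTree n

/-- Running the decision tree on an input: the output bit. -/
def DTree.eval {n : ℕ} : DTree n → (Fin n → Bool) → Bool
  | .leaf b, _ => b
  | .node i t₁ t₀, ω => if ω i then t₁.eval ω else t₀.eval ω

/-- Running the decision tree on an input: the set of coordinates queried along the way. -/
def DTree.queries {n : ℕ} : DTree n → (Fin n → Bool) → Finset (Fin n)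
  | .leaf _, _ => ∅
  | .node i t₁ t₀, ω => insert i (if ω i then t₁.queries ω else t₀.queries ω)

/-- The Bernoulli(`p`) measure on `Bool`. -/
def berMeasure (p : ℝ) : Measure Bool :=
  p.toNNReal • Measure.dirac true + (1 - p).toNNReal • Measure.dirac false

/-- The product Bernoulli(`p`) measure `P_p` on `{0,1}ⁿ`. -/
def bitsLaw (n : ℕ) (p : ℝ) : Measure (Fin n → Bool) := Measure.pi fun _ => berMeasure p

/-- A randomized algorithm, i.e. a probability distribution over decision trees, sampled
independently of the input. -/
abbrev RandAlg (n : ℕ) : Type := PMF (DTree n)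

/-- The randomized algorithm `A` determines `f` if every tree in its support computes `f`. -/
def Determines {n : ℕ} (A : RandAlg n) (f : (Fin n → Bool) → Bool) : Prop :=
  ∀ T ∈ A.support, ∀ ω, T.eval ω = f ω

/-- The revealment `δ_p(A, k)`: the probability that `A` queries bit `k` on an input drawn
from `P_p`. -/
def revealment {n : ℕ} (A : RandAlg n) (p : ℝ) (k : Fin n) : ℝ :=
  ∑' T : DTree n, (A T).toReal * ((bitsLaw n p) {ω | k ∈ T.queries ω}).toReal

/-- The maximal revealment `δ_p(A, [n]) = max_k δ_p(A, k)`. -/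
def maxRevealment {n : ℕ} (A : RandAlg n) (p : ℝ) : ℝ :=
  ⨆ k : Fin n, revealment A p k

/-- The real-valued indicator of a Boolean function. -/
def fI {n : ℕ} (f : (Fin n → Bool) → Bool) (ω : Fin n → Bool) : ℝ := if f ω then 1 else 0

/-- The mass that the Bernoulli(`q`) law gives to a bit. -/
def bitWeight (q : ℝ) (b : Bool) : ℝ := if b then q else 1 - q

/-- The expectation `E_q[g]`, written as a finite sum. -/
def bitExp {n : ℕ} (q : ℝ) (g : (Fin n → Bool) → ℝ) : ℝ :=
  ∑ ω, (∏ j, bitWeight q (ω j)) * g ω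

/-- The discrete derivative of `g` in direction `i`. -/
def coordDiff {n : ℕ} (i : Fin n) (g : (Fin n → Bool) → ℝ) (ω : Fin n → Bool) : ℝ :=
  g (Function.update ω i true) - g (Function.update ω i false)

lemma bitWeight_true (q : ℝ) : bitWeight q true = q := if_pos rfl

lemma bitWeight_false (q : ℝ) : bitWeight q false = 1 - q := if_neg Bool.false_ne_true

lemma bitWeight_nonneg {q : ℝ} (h0 : 0 ≤ q) (h1 : q ≤ 1) (b : Bool) : 0 ≤ bitWeight q b := by
  cases b <;> simp [bitWeight, h0, h1]

section BitExp

variable {n : ℕ}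

lemma bitExp_add (q : ℝ) (g h : (Fin n → Bool) → ℝ) :
    bitExp q (fun ω => g ω + h ω) = bitExp q g + bitExp q h := by
  simp [bitExp, mul_add, Finset.sum_add_distrib]

lemma bitExp_const_mul (q c : ℝ) (g : (Fin n → Bool) → ℝ) :
    bitExp q (fun ω => c * g ω) = c * bitExp q g := by
  simp only [bitExp, Finset.mul_sum]
  exact Finset.sum_congr rfl fun ω _ => by ring

lemma bitExp_mono {q : ℝ} (h0 : 0 ≤ q) (h1 : q ≤ 1) {g h : (Fin n → Bool) → ℝ}
    (hgh : ∀ ω, g ω ≤ h ω) : bitExp q g ≤ bitExp q h :=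
  Finset.sum_le_sum fun ω _ => mul_le_mul_of_nonneg_left (hgh ω)
    (Finset.prod_nonneg fun j _ => bitWeight_nonneg h0 h1 (ω j))

lemma bitExp_const (q c : ℝ) : bitExp q (fun _ : Fin n → Bool => c) = c := by
  have h : ∑ ω : Fin n → Bool, ∏ j, bitWeight q (ω j) = 1 := by
    rw [← Fintype.prod_sum (fun (_ : Fin n) b => bitWeight q b)]
    simp [bitWeight]
  rw [bitExp, ← Finset.sum_mul, h, one_mul]

lemma bitExp_nonneg {q : ℝ} (h0 : 0 ≤ q) (h1 : q ≤ 1) {g : (Fin n → Bool) → ℝ}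
    (hg : ∀ ω, 0 ≤ g ω) : 0 ≤ bitExp q g := by
  simpa [bitExp_const] using bitExp_mono h0 h1 hg

/-- Two sums over the cube agree if they agree on every pair of points differing at `i`. -/
lemma sum_eq_sum_of_update (i : Fin n) {g h : (Fin n → Bool) → ℝ}
    (hgh : ∀ ω, g (Function.update ω i true) + g (Function.update ω i false)
      = h (Function.update ω i true) + h (Function.update ω i false)) :
    ∑ ω, g ω = ∑ ω, h ω := by
  have hinv : Function.Involutive
      (fun ω : Fin n → Bool => Function.update ω i (!ω i)) := fun ω => by simp
  have hflip (k : (Fin n → Bool) → ℝ) :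
      ∑ ω, k (Function.update ω i (!ω i)) = ∑ ω, k ω := Equiv.sum_comp hinv.toPerm k
  have hpair (k : (Fin n → Bool) → ℝ) (ω : Fin n → Bool) :
      k ω + k (Function.update ω i (!ω i))
        = k (Function.update ω i true) + k (Function.update ω i false) := by
    have hω := Function.update_eq_self i ω
    cases hb : ω i <;> rw [hb] at hω <;> simp [hω, add_comm]
  have hdouble (k : (Fin n → Bool) → ℝ) : 2 * ∑ ω, k ω
      = ∑ ω, (k (Function.update ω i true) + k (Function.update ω i false)) := by
    rw [← Finset.sum_congr rfl fun ω _ => hpair k ω, Finset.sum_add_distrib, hflip, two_mul]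
  have := hdouble g
  rw [Finset.sum_congr rfl fun ω _ => hgh ω, ← hdouble h] at this
  linarith

lemma prod_bitWeight_erase_update (q : ℝ) (i : Fin n) (ω : Fin n → Bool) (b : Bool) :
    ∏ j ∈ Finset.univ.erase i, bitWeight q (Function.update ω i b j)
      = ∏ j ∈ Finset.univ.erase i, bitWeight q (ω j) :=
  Finset.prod_congr rfl fun j hj => by
    rw [Function.update_of_ne (Finset.ne_of_mem_erase hj)]

lemma prod_bitWeight_update (q : ℝ) (i : Fin n) (ω : Fin n → Bool) (b : Bool) :
    ∏ j, bitWeight q (Function.update ω i b j)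
      = bitWeight q b * ∏ j ∈ Finset.univ.erase i, bitWeight q (ω j) := by
  rw [← Finset.mul_prod_erase _ _ (Finset.mem_univ i), prod_bitWeight_erase_update,
    Function.update_self]

/-- Conditioning on the bit `i`. -/
lemma bitExp_eq_of_update (q : ℝ) (i : Fin n) {g g₁ g₀ : (Fin n → Bool) → ℝ}
    (h₁ : ∀ ω b, g (Function.update ω i true) = g₁ (Function.update ω i b))
    (h₀ : ∀ ω b, g (Function.update ω i false) = g₀ (Function.update ω i b)) :
    bitExp q g = q * bitExp q g₁ + (1 - q) * bitExp q g₀ := by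
  rw [← bitExp_const_mul, ← bitExp_const_mul, ← bitExp_add]
  refine sum_eq_sum_of_update i fun ω => ?_
  simp only [prod_bitWeight_update, ← h₁, ← h₀, bitWeight_true, bitWeight_false]
  ring

/-- The Margulis–Russo formula. -/
lemma hasDerivAt_bitExp (p : ℝ) (g : (Fin n → Bool) → ℝ) :
    HasDerivAt (fun q => bitExp q g) (∑ i, bitExp p (coordDiff i g)) p := by
  have hw (b : Bool) :
      HasDerivAt (fun q => bitWeight q b) (if b then 1 else -1) p := by
    cases b
    · simpa [bitWeight] using (hasDerivAt_id' p).const_sub 1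
    · simpa [bitWeight] using hasDerivAt_id' p
  have hd : HasDerivAt (fun q => bitExp q g)
      (∑ ω : Fin n → Bool, (∑ i, (∏ j ∈ Finset.univ.erase i, bitWeight p (ω j)) •
        (if ω i then (1 : ℝ) else -1)) * g ω) p :=
    HasDerivAt.fun_sum fun ω _ =>
      (HasDerivAt.fun_finsetProd fun i _ => hw (ω i)).mul_const (g ω)
  convert hd using 1
  simp only [Finset.sum_mul]
  rw [Finset.sum_comm]
  refine Finset.sum_congr rfl fun i _ => sum_eq_sum_of_update i fun ω => ?_
  simp only [prod_bitWeight_update, prod_bitWeight_erase_update, coordDiff,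
    Function.update_idem, Function.update_self, bitWeight_true, bitWeight_false, smul_eq_mul,
    if_true, Bool.false_eq_true, if_false]
  ring

/-- The covariance of `f` with a function that branches on the bit `i`. -/
lemma bitExp_mul_branch (q : ℝ) (i : Fin n) (f : (Fin n → Bool) → ℝ)
    {g g₁ g₀ : (Fin n → Bool) → ℝ}
    (h₁ : ∀ ω b, g (Function.update ω i true) = g₁ (Function.update ω i b))
    (h₀ : ∀ ω b, g (Function.update ω i false) = g₀ (Function.update ω i b)) :
    bitExp q (fun ω => g ω * f ω) = q * bitExp q (fun ω => g₁ ω * f ω)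
      + (1 - q) * bitExp q (fun ω => g₀ ω * f ω)
      + q * (1 - q) * bitExp q (fun ω => (g₁ ω - g₀ ω) * coordDiff i f ω) := by
  simp only [← bitExp_const_mul, ← bitExp_add]
  refine sum_eq_sum_of_update i fun ω => ?_
  simp only [prod_bitWeight_update, coordDiff, Function.update_idem, ← h₁, ← h₀,
    bitWeight_true, bitWeight_false]
  ring

/-- The OSSS inequality for a decision tree and a monotone function, run with the bits in `S`
fixed to their values under `σ`. -/
lemma covariance_eval_piecewise_le {q : ℝ} (hq0 : 0 ≤ q) (hq1 : q ≤ 1)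
    {f : (Fin n → Bool) → ℝ} (hf : ∀ i ω, 0 ≤ coordDiff i f ω)
    (T : DTree n) (S : Finset (Fin n)) (σ : Fin n → Bool) :
    bitExp q (fun ω => fI T.eval (S.piecewise σ ω) * f ω)
        - bitExp q (fun ω => fI T.eval (S.piecewise σ ω)) * bitExp q f
      ≤ q * (1 - q) * ∑ k, bitExp q (fun ω =>
          if k ∉ S ∧ k ∈ T.queries (S.piecewise σ ω) then 1 else 0)
            * bitExp q (coordDiff k f) := by
  induction T generalizing S σ with
  | leaf b => cases b <;> simp [fI, DTree.eval, DTree.queries, bitExp_const]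
  | node i t₁ t₀ ih₁ ih₀ =>
    by_cases hi : i ∈ S
    · have hbit (ω : Fin n → Bool) : S.piecewise σ ω i = σ i := by simp [hi]
      have hmem (k : Fin n) (s : Finset (Fin n)) :
          (k ∉ S ∧ k ∈ insert i s) ↔ (k ∉ S ∧ k ∈ s) := by
        rw [Finset.mem_insert]
        constructor
        · rintro ⟨hk, rfl | h⟩
          · exact absurd hi hk
          · exact ⟨hk, h⟩
        · exact fun ⟨hk, h⟩ => ⟨hk, Or.inr h⟩
      cases hσ : σ i
      · simpa only [fI, DTree.eval, DTree.queries, hbit, hσ, hmem, Bool.false_eq_true, if_false]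
          using ih₀ S σ
      · simpa only [fI, DTree.eval, DTree.queries, hbit, hσ, hmem, if_true] using ih₁ S σ
    · have hpw (ω : Fin n → Bool) (b b' : Bool) :
          (insert i S).piecewise (Function.update σ i b) (Function.update ω i b')
            = S.piecewise σ (Function.update ω i b) := by
        ext j
        by_cases hj : j = i
        · subst hj; simp [hi]
        · by_cases hS : j ∈ S <;> simp [hj, hS]
      have hbit (ω : Fin n → Bool) (b : Bool) :
          S.piecewise σ (Function.update ω i b) i = b := by simp [hi]
      have h₁ := ih₁ (insert i S) (Function.update σ i true)
      have h₀ := ih₀ (insert i S) (Function.update σ i false)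
      set g : (Fin n → Bool) → ℝ := fun ω => fI (DTree.node i t₁ t₀).eval (S.piecewise σ ω)
      set g₁ : (Fin n → Bool) → ℝ := fun ω =>
        fI t₁.eval ((insert i S).piecewise (Function.update σ i true) ω)
      set g₀ : (Fin n → Bool) → ℝ := fun ω =>
        fI t₀.eval ((insert i S).piecewise (Function.update σ i false) ω)
      have hg1 (ω b) : g (Function.update ω i true) = g₁ (Function.update ω i b) := by
        simp [g, g₁, fI, DTree.eval, hpw, hi]
      have hg0 (ω b) : g (Function.update ω i false) = g₀ (Function.update ω i b) := by
        simp [g, g₀, fI, DTree.eval, hpw, hi]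
      have hreveal (k : Fin n) : bitExp q (fun ω => if k ∉ S ∧
            k ∈ (DTree.node i t₁ t₀).queries (S.piecewise σ ω) then (1 : ℝ) else 0)
          = (if k = i then 1 else 0)
            + (q * bitExp q (fun ω => if k ∉ insert i S ∧ k ∈ t₁.queries
                ((insert i S).piecewise (Function.update σ i true) ω) then 1 else 0)
              + (1 - q) * bitExp q (fun ω => if k ∉ insert i S ∧ k ∈ t₀.queries
                ((insert i S).piecewise (Function.update σ i false) ω) then 1 else 0)) := by
        by_cases hk : k = i
        · subst hk
          simp [DTree.queries, hi, bitExp_const]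
        · rw [if_neg hk, zero_add]
          refine bitExp_eq_of_update q i (fun ω b => ?_) (fun ω b => ?_) <;>
            simp [DTree.queries, hpw, hbit, hk]
      have hbranch : bitExp q (fun ω => (g₁ ω - g₀ ω) * coordDiff i f ω)
          ≤ bitExp q (coordDiff i f) := by
        refine bitExp_mono hq0 hq1 fun ω => mul_le_of_le_one_left (hf i ω) ?_
        simp only [g₁, g₀, fI]
        split_ifs <;> norm_num
      have hq : 0 ≤ 1 - q := by linarith
      simp only [hreveal, add_mul, Finset.sum_add_distrib, ite_mul, one_mul, zero_mul,
        Finset.sum_ite_eq', Finset.mem_univ, if_true, mul_assoc, ← Finset.mul_sum]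
      rw [bitExp_mul_branch q i f hg1 hg0, bitExp_eq_of_update q i hg1 hg0]
      have e₁ := mul_le_mul_of_nonneg_left h₁ hq0
      have e₀ := mul_le_mul_of_nonneg_left h₀ hq
      have e := mul_le_mul_of_nonneg_left hbranch (mul_nonneg hq0 hq)
      linarith

/-- The OSSS inequality for a decision tree and a monotone function. -/
lemma covariance_eval_le {q : ℝ} (hq0 : 0 ≤ q) (hq1 : q ≤ 1)
    {f : (Fin n → Bool) → ℝ} (hf : ∀ i ω, 0 ≤ coordDiff i f ω) (T : DTree n) :
    bitExp q (fun ω => fI T.eval ω * f ω) - bitExp q (fI T.eval) * bitExp q f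
      ≤ q * (1 - q) * ∑ k, bitExp q (fun ω => if k ∈ T.queries ω then 1 else 0)
          * bitExp q (coordDiff k f) := by
  simpa using covariance_eval_piecewise_le hq0 hq1 hf T ∅ (fun _ => true)

instance (q : ℝ) : IsFiniteMeasure (berMeasure q) := by
  unfold berMeasure; infer_instance

instance (q : ℝ) : IsFiniteMeasure (bitsLaw n q) := by
  unfold bitsLaw; infer_instance

lemma berMeasure_real_singleton {q : ℝ} (h0 : 0 ≤ q) (h1 : q ≤ 1) (b : Bool) :
    (berMeasure q).real {b} = bitWeight q b := by
  cases b <;> simp [berMeasure, bitWeight, measureReal_def, h0, h1]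

lemma integral_bitsLaw {q : ℝ} (h0 : 0 ≤ q) (h1 : q ≤ 1) (g : (Fin n → Bool) → ℝ) :
    ∫ ω, g ω ∂(bitsLaw n q) = bitExp q g := by
  rw [integral_fintype (Integrable.of_finite), bitExp]
  refine Finset.sum_congr rfl fun ω _ => ?_
  rw [smul_eq_mul, measureReal_def, bitsLaw, Measure.pi_singleton, ENNReal.toReal_prod]
  congr 1
  exact Finset.prod_congr rfl fun j _ => berMeasure_real_singleton h0 h1 (ω j)

lemma toReal_bitsLaw_setOf {q : ℝ} (h0 : 0 ≤ q) (h1 : q ≤ 1)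
    (P : (Fin n → Bool) → Prop) [DecidablePred P] :
    (bitsLaw n q {ω | P ω}).toReal = bitExp q (fun ω => if P ω then 1 else 0) := by
  rw [← integral_bitsLaw h0 h1, ← measureReal_def,
    ← integral_indicator_one (Set.toFinite _).measurableSet]
  simp [Set.indicator_apply]

/-- The OSSS inequality for a randomized algorithm determining a monotone Boolean function. -/
lemma variance_le_sum_revealment {q : ℝ} (hq0 : 0 ≤ q) (hq1 : q ≤ 1)
    {f : (Fin n → Bool) → Bool} (hf : ∀ i ω, 0 ≤ coordDiff i (fI f) ω)
    {A : RandAlg n} (hA : Determines A f) :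
    bitExp q (fun ω => fI f ω ^ 2) - bitExp q (fI f) ^ 2
      ≤ q * (1 - q) * ∑ k, revealment A q k * bitExp q (coordDiff k (fI f)) := by
  set c : DTree n → Fin n → ℝ := fun T k =>
    bitExp q (fun ω => if k ∈ T.queries ω then 1 else 0)
  have hA_sum : HasSum (fun T => (A T).toReal) 1 := by
    have := ENNReal.hasSum_toReal (f := A) (by simp [A.tsum_coe])
    rwa [← ENNReal.tsum_toReal_eq A.apply_ne_top, A.tsum_coe, ENNReal.toReal_one] at this
  have hc_nonneg (T k) : 0 ≤ c T k := bitExp_nonneg hq0 hq1 fun ω => by split_ifs <;> norm_num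
  have hc_le_one (T k) : c T k ≤ 1 := by
    have : c T k ≤ bitExp q (fun _ => 1) :=
      bitExp_mono hq0 hq1 fun ω => by split_ifs <;> norm_num
    rwa [bitExp_const] at this
  have hrev (k : Fin n) : HasSum (fun T => (A T).toReal * c T k) (revealment A q k) := by
    have hs : Summable (fun T => (A T).toReal * c T k) :=
      Summable.of_nonneg_of_le (fun T => mul_nonneg ENNReal.toReal_nonneg (hc_nonneg T k))
        (fun T => mul_le_of_le_one_right ENNReal.toReal_nonneg (hc_le_one T k)) hA_sum.summable
    have he : revealment A q k = ∑' T, (A T).toReal * c T k :=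
      tsum_congr fun T => by rw [toReal_bitsLaw_setOf hq0 hq1]
    exact he ▸ hs.hasSum
  have hright := (hasSum_sum fun k (_ : k ∈ Finset.univ) =>
    (hrev k).mul_right (bitExp q (coordDiff k (fI f)))).mul_left (q * (1 - q))
  have hleft := hA_sum.mul_right (bitExp q (fun ω => fI f ω ^ 2) - bitExp q (fI f) ^ 2)
  rw [one_mul] at hleft
  refine hasSum_le (fun T => ?_) hleft hright
  by_cases hT : A T = 0
  · simp [hT]
  · have heval : T.eval = f := funext (hA T ((A.mem_support_iff T).2 hT))
    have := covariance_eval_le hq0 hq1 hf T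
    rw [heval] at this
    simp only [← sq] at this
    calc _ ≤ (A T).toReal * _ := mul_le_mul_of_nonneg_left this ENNReal.toReal_nonneg
      _ = _ := by
        simp only [Finset.mul_sum]
        exact Finset.sum_congr rfl fun k _ => by ring

end BitExp

/-- **Lower bound on the derivative via revealment (Section 2.2).** If `f` is monotone and the
randomized algorithm `A` determines `f`, then `q ↦ E_q[f]` is differentiable at `p` with
derivative at least `4 Var_p(f) / δ_p(A,[n])`. -/
theorem derivative_lower_bound_via_revealment
    {n : ℕ} (hn : 0 < n) (f : (Fin n → Bool) → Bool)
    (hmono : ∀ ω ω' : Fin n → Bool, (∀ i, ω i = true → ω' i = true) →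
      f ω = true → f ω' = true)
    (A : RandAlg n) (hdet : Determines A f)
    (p : ℝ) (hp : p ∈ Set.Ioo (0:ℝ) 1) (hδ : 0 < maxRevealment A p) :
    ∃ D : ℝ, HasDerivAt (fun q : ℝ => ∫ ω, fI f ω ∂(bitsLaw n q)) D p ∧
      4 * ((∫ ω, (fI f ω) ^ 2 ∂(bitsLaw n p)) - (∫ ω, fI f ω ∂(bitsLaw n p)) ^ 2)
          / maxRevealment A p ≤ D := by
  have hp0 := hp.1.le
  have hp1 := hp.2.le
  have hf (i : Fin n) (ω : Fin n → Bool) : 0 ≤ coordDiff i (fI f) ω := by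
    have := hmono (Function.update ω i false) (Function.update ω i true) fun j hj => by
      by_cases h : j = i
      · subst h; simp
      · simpa [h] using hj
    simp only [coordDiff, fI]
    split_ifs <;> simp_all
  refine ⟨∑ i, bitExp p (coordDiff i (fI f)), ?_, ?_⟩
  · refine (hasDerivAt_bitExp p (fI f)).congr_of_eventuallyEq ?_
    filter_upwards [Ioo_mem_nhds hp.1 hp.2] with q hq
    exact integral_bitsLaw hq.1.le hq.2.le _
  · rw [integral_bitsLaw hp0 hp1, integral_bitsLaw hp0 hp1, div_le_iff₀ hδ]
    have hI (k : Fin n) : 0 ≤ bitExp p (coordDiff k (fI f)) := bitExp_nonneg hp0 hp1 (hf k)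
    have hsum : ∑ k, revealment A p k * bitExp p (coordDiff k (fI f))
        ≤ maxRevealment A p * ∑ k, bitExp p (coordDiff k (fI f)) := by
      rw [Finset.mul_sum]
      exact Finset.sum_le_sum fun k _ => mul_le_mul_of_nonneg_right
        (le_ciSup (Set.finite_range (revealment A p)).bddAbove k) (hI k)
    have hprod := mul_nonneg hδ.le (Finset.sum_nonneg fun k (_ : k ∈ Finset.univ) => hI k)
    have hvar := (variance_le_sum_revealment hp0 hp1 hf hdet).trans
      (mul_le_mul_of_nonneg_left hsum (mul_nonneg hp0 (sub_nonneg.2 hp1)))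
    nlinarith [mul_nonneg (sq_nonneg (2 * p - 1)) hprod]
end
end
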